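/- arXiv:1604.03394 — 12 statements merged into one kernel-verified Lean document; each statement's English description precedes it below -/
import Mathlib

section
/- (Theorem 3) Let β > 0 and h > 0. For every r > 0, μ(r·h, β)² + μ(h/r, β)² ≥ 2·μ(h, β)². In other words, among all rectangles (−rh, rh) × (−h/r, h/r) of fixed area 4h², the fundamental Robin eigenvalue λ₁ = μ(rh, β)² + μ(h/r, β)² is smallest for the square (r = 1). -/
open Real

theorem sin_pos_and_cos_pos_of_mem_Ioo {x : ℝ} (hx : x ∈ Set.Ioo 0 (π / 2)) :
    0 < sin x ∧ 0 < cos x :=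
  ⟨sin_pos_of_pos_of_lt_pi hx.1 (by linarith [hx.2, pi_pos]),
    cos_pos_of_mem_Ioo ⟨by linarith [hx.1, pi_pos], hx.2⟩⟩

theorem monotoneOn_tan_div_self : MonotoneOn (fun x : ℝ => tan x / x) (Set.Ioo 0 (π / 2)) := by
  have hd : ∀ x ∈ Set.Ioo 0 (π / 2), HasDerivAt (fun x : ℝ => tan x / x)
      ((1 / cos x ^ 2 * x - tan x * 1) / x ^ 2) x := fun x hx =>
    (hasDerivAt_tan (sin_pos_and_cos_pos_of_mem_Ioo hx).2.ne').div (hasDerivAt_id x) hx.1.ne'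
  refine monotoneOn_of_deriv_nonneg (convex_Ioo _ _)
    (fun x hx => (hd x hx).continuousAt.continuousWithinAt)
    (fun x hx => (hd x (interior_subset hx)).differentiableAt.differentiableWithinAt) ?_
  intro x hx
  rw [interior_Ioo] at hx
  rw [(hd x hx).deriv]
  obtain ⟨h_sin, h_cos⟩ := sin_pos_and_cos_pos_of_mem_Ioo hx
  have h : 1 / cos x ^ 2 * x - tan x * 1 = (x - sin x * cos x) / cos x ^ 2 := by
    rw [tan_eq_sin_div_cos]
    field_simp
  rw [h]
  have : sin x * cos x ≤ x := by
    nlinarith [sin_le hx.1.le, cos_le_one x]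
  have := sub_nonneg.2 this
  positivity

theorem monotoneOn_sin_sq_mul_tan_div_self_add_tan_sq :
    MonotoneOn (fun x : ℝ => sin x ^ 2 * (tan x / x) + tan x ^ 2) (Set.Ioo 0 (π / 2)) := by
  intro x hx y hy hxy
  have h_tan : tan x / x ≤ tan y / y := monotoneOn_tan_div_self hx hy hxy
  have h_sin : sin x ≤ sin y :=
    sin_le_sin_of_le_of_le_pi_div_two (by linarith [hx.1, pi_pos]) hy.2.le hxy
  have h_tan' : tan x ≤ tan y := strictMonoOn_tan.monotoneOn
    ⟨by linarith [hx.1, pi_pos], hx.2⟩ ⟨by linarith [hy.1, pi_pos], hy.2⟩ hxy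
  have h0 := (sin_pos_and_cos_pos_of_mem_Ioo hx).1.le
  have h1 := (tan_pos_of_pos_of_lt_pi_div_two hx.1 hx.2).le
  have h2 := hx.1.le
  dsimp only
  gcongr

/-- The function `cot² x`, viewed as a function of `log (x * tan x)`, lies above each of its
tangent lines. -/
theorem exists_tangent_slope_cot_sq {s : ℝ} (hs : s ∈ Set.Ioo 0 (π / 2)) :
    ∃ l : ℝ, ∀ x ∈ Set.Ioo 0 (π / 2),
      (cos s / sin s) ^ 2 + l * log (s * tan s) ≤ (cos x / sin x) ^ 2 + l * log (x * tan x) := by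
  set P : ℝ → ℝ := fun x => sin x ^ 2 * (tan x / x) + tan x ^ 2 with hP
  have hP_pos : ∀ x ∈ Set.Ioo 0 (π / 2), 0 < P x := fun x hx => by
    have := (sin_pos_and_cos_pos_of_mem_Ioo hx).1
    have := tan_pos_of_pos_of_lt_pi_div_two hx.1 hx.2
    have := hx.1
    positivity
  have hP_mono : MonotoneOn P (Set.Ioo 0 (π / 2)) := monotoneOn_sin_sq_mul_tan_div_self_add_tan_sq
  have hPs := hP_pos s hs
  refine ⟨2 / P s, ?_⟩
  set φ : ℝ → ℝ := fun x => (cos x / sin x) ^ 2 + 2 / P s * log (x * tan x) with hφ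
  have hd : ∀ x ∈ Set.Ioo 0 (π / 2),
      HasDerivAt φ (2 * cos x / sin x ^ 3 / P s * (P x - P s)) x := fun x hx => by
    obtain ⟨h_sin, h_cos⟩ := sin_pos_and_cos_pos_of_mem_Ioo hx
    have h_tan := tan_pos_of_pos_of_lt_pi_div_two hx.1 hx.2
    have hx0 := hx.1
    have h := (((hasDerivAt_cos x).div (hasDerivAt_sin x) h_sin.ne').pow 2).add
      ((((hasDerivAt_id x).mul (hasDerivAt_tan h_cos.ne')).log
        (mul_pos hx0 h_tan).ne').const_mul (2 / P s))
    refine HasDerivAt.congr_deriv (f := φ) h ?_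
    have h_num : -sin x * sin x - cos x * cos x = -1 := by linarith [sin_sq_add_cos_sq x]
    have hPx : P x = sin x ^ 3 / (x * cos x) + sin x ^ 2 / cos x ^ 2 := by
      simp only [hP, tan_eq_sin_div_cos]
      field_simp
    simp only [id, Pi.div_apply, Pi.mul_apply, Nat.add_one_sub_one, pow_one, Nat.cast_ofNat]
    rw [h_num, hPx, tan_eq_sin_div_cos]
    generalize P s = p at hPs ⊢
    field_simp
    ring
  intro x hx
  change φ s ≤ φ x
  rcases le_total x s with hxs | hxs
  · have hsub : Set.Icc x s ⊆ Set.Ioo 0 (π / 2) := fun z hz =>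
      ⟨hx.1.trans_le hz.1, hz.2.trans_lt hs.2⟩
    refine antitoneOn_of_deriv_nonpos (convex_Icc x s)
      (fun z hz => (hd z (hsub hz)).continuousAt.continuousWithinAt)
      (fun z hz => (hd z (hsub (interior_subset hz))).differentiableAt.differentiableWithinAt)
      (fun z hz => ?_) (Set.left_mem_Icc.2 hxs) (Set.right_mem_Icc.2 hxs) hxs
    have hz' := interior_subset hz
    obtain ⟨h_sin, h_cos⟩ := sin_pos_and_cos_pos_of_mem_Ioo (hsub hz')
    rw [(hd z (hsub hz')).deriv]
    exact mul_nonpos_of_nonneg_of_nonpos (by positivity)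
      (sub_nonpos.2 (hP_mono (hsub hz') hs hz'.2))
  · have hsub : Set.Icc s x ⊆ Set.Ioo 0 (π / 2) := fun z hz =>
      ⟨hs.1.trans_le hz.1, hz.2.trans_lt hx.2⟩
    refine monotoneOn_of_deriv_nonneg (convex_Icc s x)
      (fun z hz => (hd z (hsub hz)).continuousAt.continuousWithinAt)
      (fun z hz => (hd z (hsub (interior_subset hz))).differentiableAt.differentiableWithinAt)
      (fun z hz => ?_) (Set.left_mem_Icc.2 hxs) (Set.right_mem_Icc.2 hxs) hxs
    have hz' := interior_subset hz
    obtain ⟨h_sin, h_cos⟩ := sin_pos_and_cos_pos_of_mem_Ioo (hsub hz')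
    rw [(hd z (hsub hz')).deriv]
    exact mul_nonneg (by positivity) (sub_nonneg.2 (hP_mono hs (hsub hz') hz'.1))

/-- The Robin equation `m * tan (m * c) = k` rewritten in terms of the angle `m * c`. -/
theorem robin_angle {k c m : ℝ} (hk : 0 < k) (hc : 0 < c)
    (hm : m ∈ Set.Ioo 0 (π / (2 * c)) ∧ m * tan (m * c) = k) :
    m * c ∈ Set.Ioo 0 (π / 2) ∧ m ^ 2 = k ^ 2 * (cos (m * c) / sin (m * c)) ^ 2 ∧
      log (m * c * tan (m * c)) = log k + log c := by
  obtain ⟨⟨hm0, hm1⟩, h⟩ := hm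
  have hx : m * c ∈ Set.Ioo 0 (π / 2) := by
    refine ⟨mul_pos hm0 hc, ?_⟩
    rw [lt_div_iff₀ (by positivity)] at hm1
    linarith
  obtain ⟨h_sin, h_cos⟩ := sin_pos_and_cos_pos_of_mem_Ioo hx
  refine ⟨hx, ?_, ?_⟩
  · rw [tan_eq_sin_div_cos] at h
    rw [← mul_pow, ← h]
    congr 1
    field_simp
  · rw [mul_right_comm, h, log_mul hk.ne' hc.ne']

/-- **Theorem 3.** Let `β > 0` and `h > 0`.  For every `r > 0`, with `μ(c, β)` the
unique number in `(0, π/(2c))` satisfying `μ · tan(μ·c) = 1/β`, one has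
`μ(r·h, β)² + μ(h/r, β)² ≥ 2·μ(h, β)²`:  among all rectangles
`(−rh, rh) × (−h/r, h/r)` of fixed area `4h²`, the fundamental Robin eigenvalue
`λ₁ = μ(rh, β)² + μ(h/r, β)²` is smallest for the square (`r = 1`). -/
theorem lambda1_rectangle_ge_square (β h r : ℝ) (hβ : 0 < β) (hh : 0 < h) (hr : 0 < r)
    (μX μY μS : ℝ)
    (hX : μX ∈ Set.Ioo 0 (π / (2 * (r * h))) ∧ μX * Real.tan (μX * (r * h)) = 1 / β)
    (hY : μY ∈ Set.Ioo 0 (π / (2 * (h / r))) ∧ μY * Real.tan (μY * (h / r)) = 1 / β)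
    (hS : μS ∈ Set.Ioo 0 (π / (2 * h)) ∧ μS * Real.tan (μS * h) = 1 / β) :
    μX ^ 2 + μY ^ 2 ≥ 2 * μS ^ 2 := by
  have hk : 0 < 1 / β := by positivity
  obtain ⟨hx, hx_sq, hx_log⟩ := robin_angle hk (by positivity) hX
  obtain ⟨hy, hy_sq, hy_log⟩ := robin_angle hk (by positivity) hY
  obtain ⟨hs, hs_sq, hs_log⟩ := robin_angle hk hh hS
  obtain ⟨l, hl⟩ := exists_tangent_slope_cot_sq hs
  have hlx := hl _ hx
  have hly := hl _ hy
  rw [hs_log, hx_log, log_mul hr.ne' hh.ne'] at hlx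
  rw [hs_log, hy_log, log_div hh.ne' hr.ne'] at hly
  have h_cot : 2 * (cos (μS * h) / sin (μS * h)) ^ 2 ≤
      (cos (μX * (r * h)) / sin (μX * (r * h))) ^ 2 +
        (cos (μY * (h / r)) / sin (μY * (h / r))) ^ 2 := by
    linarith
  rw [hx_sq, hy_sq, hs_sq]
  linarith [mul_le_mul_of_nonneg_left h_cot (sq_nonneg (1 / β))]
end

section
/- Fix β > 0. The function c ↦ μ(c, β) is differentiable on (0, ∞) and at every c > 0 its derivative equals −μ·(1 + β²·μ²)/(β + c·(1 + β²·μ²)), where μ = μ(c, β). -/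
open Real

/-- The inverse of `c ↦ μ(c, β)`, in closed form. -/
noncomputable def muInv (β x : ℝ) : ℝ := x⁻¹ * arctan (β * x)⁻¹

theorem muInv_pos {β x : ℝ} (hβ : 0 < β) (hx : 0 < x) : 0 < muInv β x :=
  mul_pos (inv_pos.2 hx) (arctan_pos.2 (by positivity))

theorem muInv_strictAntiOn {β : ℝ} (hβ : 0 < β) : StrictAntiOn (muInv β) (Set.Ioi 0) := by
  intro x hx y hy hxy
  rw [Set.mem_Ioi] at hx hy
  have hβx : 0 < β * x := by positivity
  have h : β * x < β * y := by gcongr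
  exact mul_lt_mul'' (inv_strictAnti₀ hx hxy)
    (arctan_strictMono (inv_strictAnti₀ hβx h)) (by positivity)
    (arctan_pos.2 (by positivity)).le

theorem muInv_hasStrictDerivAt {β x : ℝ} (hβ : 0 < β) (hx : 0 < x) :
    HasStrictDerivAt (muInv β)
      (-(β + muInv β x * (1 + β ^ 2 * x ^ 2)) / (x * (1 + β ^ 2 * x ^ 2))) x := by
  have hlin : HasStrictDerivAt (fun y : ℝ => β * y) β x := by
    simpa using (hasStrictDerivAt_id x).const_mul β
  have hatan := ((hasStrictDerivAt_inv (mul_pos hβ hx).ne').comp x hlin).arctan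
  refine ((hasStrictDerivAt_inv hx.ne').mul hatan).congr_deriv ?_
  simp only [muInv, Function.comp_apply]
  field_simp
  ring

theorem muInv_eq_of_mul_tan_eq {β c x : ℝ} (hc : 0 < c) (hx : x ∈ Set.Ioo 0 (π / (2 * c)))
    (h : x * tan (x * c) = 1 / β) : muInv β x = c := by
  obtain ⟨hx0, hxc⟩ := hx
  have hlt : x * c < π / 2 := by
    rw [lt_div_iff₀ (by positivity)] at hxc
    linarith
  have hpos : 0 < x * c := by positivity
  have htan : (β * x)⁻¹ = tan (x * c) := by
    rw [mul_inv, ← one_div β, ← h]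
    field_simp
  rw [muInv, htan, arctan_tan (by linarith) hlt]
  field_simp

/-- Fix `β > 0` and let `m : ℝ → ℝ` be such that for each `c > 0`, `m c = μ(c, β)` is the
unique number in `(0, π/(2c))` with `μ · tan(μ·c) = 1/β`.  Then `m` is differentiable on
`(0, ∞)` and at every `c > 0` its derivative equals
`−μ·(1 + β²·μ²)/(β + c·(1 + β²·μ²))` where `μ = m c`. -/
theorem mu_hasDerivAt (β : ℝ) (hβ : 0 < β) (m : ℝ → ℝ)
    (hm : ∀ c : ℝ, 0 < c →
      m c ∈ Set.Ioo 0 (π / (2 * c)) ∧ m c * Real.tan (m c * c) = 1 / β) :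
    ∀ c : ℝ, 0 < c →
      HasDerivAt m
        (-(m c * (1 + β ^ 2 * (m c) ^ 2)) / (β + c * (1 + β ^ 2 * (m c) ^ 2))) c := by
  have hright : ∀ c, 0 < c → muInv β (m c) = c := fun c hc =>
    muInv_eq_of_mul_tan_eq hc (hm c hc).1 (hm c hc).2
  have hleft : ∀ x, 0 < x → m (muInv β x) = x := fun x hx =>
    (muInv_strictAntiOn hβ).injOn (hm _ (muInv_pos hβ hx)).1.1 hx (hright _ (muInv_pos hβ hx))
  intro c hc
  have hmc : 0 < m c := (hm c hc).1.1
  have hderiv := muInv_hasStrictDerivAt hβ hmc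
  rw [hright c hc] at hderiv
  have hne : -(β + c * (1 + β ^ 2 * m c ^ 2)) / (m c * (1 + β ^ 2 * m c ^ 2)) ≠ 0 :=
    div_ne_zero (neg_ne_zero.2 (by positivity)) (by positivity)
  have hm' := (hderiv.to_local_left_inverse hne
    ((lt_mem_nhds hmc).mono hleft)).hasDerivAt
  rw [hright c hc] at hm'
  refine hm'.congr_deriv ?_
  rw [inv_div, div_neg, neg_div]
end

section
/- Fix β > 0. The function c ↦ μ(c, β) is strictly decreasing on (0, ∞): if 0 < c₁ < c₂ then μ(c₁, β) > μ(c₂, β). -/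
open Real

/-- Fix `β > 0` and let `m : ℝ → ℝ` be such that for each `c > 0`, `m c = μ(c, β)` is the
unique number in `(0, π/(2c))` with `μ · tan(μ·c) = 1/β`.  Then `c ↦ m c` is strictly
decreasing on `(0, ∞)`: if `0 < c₁ < c₂` then `m c₁ > m c₂`. -/
theorem mu_strictAnti (β : ℝ) (hβ : 0 < β) (m : ℝ → ℝ)
    (hm : ∀ c : ℝ, 0 < c →
      m c ∈ Set.Ioo 0 (π / (2 * c)) ∧ m c * Real.tan (m c * c) = 1 / β) :
    ∀ c₁ c₂ : ℝ, 0 < c₁ → c₁ < c₂ → m c₂ < m c₁ := by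
  intro c₁ c₂ hc₁ hc
  have hc₂ : 0 < c₂ := hc₁.trans hc
  obtain ⟨⟨hpos₁, -⟩, heq₁⟩ := hm c₁ hc₁
  obtain ⟨⟨hpos₂, hlt₂⟩, heq₂⟩ := hm c₂ hc₂
  by_contra! hle
  have harg : m c₁ * c₁ < m c₂ * c₂ := mul_lt_mul' hle hc hc₁.le hpos₂
  have hhalf : m c₂ * c₂ < π / 2 := by
    rw [lt_div_iff₀ (by positivity)] at hlt₂
    linarith
  have harg_pos : 0 < m c₁ * c₁ := mul_pos hpos₁ hc₁
  have htan : Real.tan (m c₁ * c₁) < Real.tan (m c₂ * c₂) :=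
    Real.tan_lt_tan_of_nonneg_of_lt_pi_div_two harg_pos.le hhalf harg
  have htan_pos : 0 < Real.tan (m c₁ * c₁) :=
    Real.tan_pos_of_pos_of_lt_pi_div_two harg_pos (harg.trans hhalf)
  exact (mul_lt_mul' hle htan htan_pos.le hpos₂).ne (heq₁.trans heq₂.symm)
end

section
/- Fix β > 0. The function c ↦ log(μ(c, β)) is convex on (0, ∞); that is, μ(c, β) is a log-convex function of c. -/
open Real

theorem strictMono_exp_mul_arctan_exp {k : ℝ} (hk : 0 < k) :
    StrictMono fun u : ℝ => exp u * arctan (k * exp u) := by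
  intro x y hxy
  have hexp : exp x < exp y := exp_lt_exp.2 hxy
  have harctan : arctan (k * exp x) < arctan (k * exp y) :=
    arctan_strictMono (mul_lt_mul_of_pos_left hexp hk)
  have hpos : 0 < arctan (k * exp x) := arctan_pos.2 (by positivity)
  exact mul_lt_mul hexp harctan.le hpos (exp_pos y).le

theorem convexOn_exp_mul_arctan_exp {k : ℝ} (hk : 0 < k) :
    ConvexOn ℝ Set.univ fun u : ℝ => exp u * arctan (k * exp u) := by
  have hderiv (u : ℝ) : HasDerivAt (fun u : ℝ => exp u * arctan (k * exp u))
      (exp u * arctan (k * exp u) + exp u * (1 / (1 + (k * exp u) ^ 2) * (k * exp u))) u :=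
    (hasDerivAt_exp u).mul ((hasDerivAt_exp u).const_mul k).arctan
  refine Monotone.convexOn_univ_of_deriv (fun u => (hderiv u).differentiableAt) ?_
  intro x y hxy
  rw [(hderiv x).deriv, (hderiv y).deriv]
  refine add_le_add ((strictMono_exp_mul_arctan_exp hk).monotone hxy) ?_
  have hexp : exp x ≤ exp y := exp_le_exp.2 hxy
  have hsq : exp x ^ 2 ≤ exp y ^ 2 := pow_le_pow_left₀ (exp_pos x).le hexp 2
  have hrw (u : ℝ) : exp u * (1 / (1 + (k * exp u) ^ 2) * (k * exp u)) =
      k * exp u ^ 2 / (1 + (k * exp u) ^ 2) := by ring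
  rw [hrw, hrw, div_le_div_iff₀ (by positivity) (by positivity)]
  linarith [mul_le_mul_of_nonneg_left hsq hk.le]

/-- Fix `β > 0` and let `m : ℝ → ℝ` be such that for each `c > 0`, `m c = μ(c, β)` is the
unique number in `(0, π/(2c))` with `μ · tan(μ·c) = 1/β`.  Then `c ↦ log (m c)` is convex
on `(0, ∞)`; that is, `μ(c, β)` is a log-convex function of `c`. -/
theorem mu_logConvex (β : ℝ) (hβ : 0 < β) (m : ℝ → ℝ)
    (hm : ∀ c : ℝ, 0 < c →
      m c ∈ Set.Ioo 0 (π / (2 * c)) ∧ m c * Real.tan (m c * c) = 1 / β) :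
    ConvexOn ℝ (Set.Ioi (0 : ℝ)) (fun c => Real.log (m c)) := by
  have hk : 0 < 1 / β := by positivity
  have hinv (c : ℝ) (hc : 0 < c) :
      exp (-log (m c)) * arctan (1 / β * exp (-log (m c))) = c := by
    obtain ⟨⟨hpos, hlt⟩, htan⟩ := hm c hc
    have hlt' : m c * c < π / 2 := by
      rw [lt_div_iff₀ (by positivity)] at hlt
      linarith
    have hmc : 0 < m c * c := by positivity
    have harg : 1 / β * (m c)⁻¹ = tan (m c * c) := by
      rw [← htan]
      field_simp
    rw [exp_neg, exp_log hpos, harg, arctan_tan (by linarith [pi_pos]) hlt']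
    field_simp
  refine ⟨convex_Ioi 0, fun x hx y hy a b ha hb hab => ?_⟩
  have hxy : 0 < a • x + b • y := convex_Ioi (0 : ℝ) hx hy ha hb hab
  have hconv := (convexOn_exp_mul_arctan_exp hk).2 (Set.mem_univ (-log (m x)))
    (Set.mem_univ (-log (m y))) ha hb hab
  simp only [hinv x hx, hinv y hy] at hconv
  rw [← hinv _ hxy] at hconv
  have hle := (strictMono_exp_mul_arctan_exp hk).le_iff_le.1 hconv
  simp only [smul_eq_mul] at hle ⊢
  linarith
end

section
/- (Lemma 1, log-convexity) The function z ↦ log(φ₁(z)), where φ₁(z) = (1/z)·arctan(1/z), is convex on (0, ∞). -/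
open Real

theorem div_one_add_sq_le_arctan {x : ℝ} (hx : 0 ≤ x) : x / (1 + x ^ 2) ≤ arctan x := by
  have h : sin (2 * arctan x) = 2 * (x / (1 + x ^ 2)) := by
    rw [sin_two_mul, ← tan_mul_cos (cos_arctan_pos x).ne', tan_arctan, mul_assoc, mul_assoc,
      ← sq, cos_sq_arctan, mul_one_div]
  have := sin_le (x := 2 * arctan x) (by have := arctan_nonneg.2 hx; linarith)
  linarith

theorem hasDerivAt_arctan_one_div {x : ℝ} (hx : x ≠ 0) :
    HasDerivAt (fun z : ℝ => arctan (1 / z)) (-(1 / (1 + x ^ 2))) x := by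
  have h : HasDerivAt (fun z : ℝ => 1 / z) (-(x ^ 2)⁻¹) x := by
    simpa only [one_div] using hasDerivAt_inv hx
  convert h.arctan using 1
  field_simp
  ring

theorem hasDerivAt_log_one_div_mul_arctan_one_div {x : ℝ} (hx : 0 < x) :
    HasDerivAt (fun z : ℝ => log ((1 / z) * arctan (1 / z)))
      (-(1 / x) - 1 / ((1 + x ^ 2) * arctan (1 / x))) x := by
  have hA : 0 < arctan (1 / x) := arctan_pos.2 (one_div_pos.2 hx)
  have h : HasDerivAt (fun z : ℝ => 1 / z) (-(x ^ 2)⁻¹) x := by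
    simpa only [one_div] using hasDerivAt_inv hx.ne'
  have hm : HasDerivAt (fun z : ℝ => (1 / z) * arctan (1 / z))
      (-(x ^ 2)⁻¹ * arctan (1 / x) + 1 / x * -(1 / (1 + x ^ 2))) x :=
    h.mul (hasDerivAt_arctan_one_div hx.ne')
  refine (hm.log (by positivity)).congr_deriv ?_
  generalize arctan (1 / x) = A at hA ⊢
  field_simp
  ring

theorem hasDerivAt_neg_one_div_sub_one_div_mul_arctan {x : ℝ} (hx : 0 < x) :
    HasDerivAt (fun z : ℝ => -(1 / z) - 1 / ((1 + z ^ 2) * arctan (1 / z)))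
      (1 / x ^ 2 + (2 * x * arctan (1 / x) - 1) / ((1 + x ^ 2) * arctan (1 / x)) ^ 2) x := by
  have hp : HasDerivAt (fun z : ℝ => (1 + z ^ 2) * arctan (1 / z))
      (2 * x * arctan (1 / x) - 1) x := by
    refine (((hasDerivAt_pow 2 x).const_add 1).mul
      (hasDerivAt_arctan_one_div hx.ne')).congr_deriv ?_
    generalize arctan (1 / x) = A
    push_cast
    field_simp
    ring
  simp only [one_div] at hp ⊢
  refine ((hasDerivAt_inv hx.ne').neg.sub (hp.inv (by positivity))).congr_deriv ?_
  ring

/-- **Lemma 1 (log-convexity).** The function `z ↦ log (φ₁ z)`, where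
`φ₁(z) = (1/z)·arctan(1/z)`, is convex on `(0, ∞)`. -/
theorem phi1_logConvex :
    ConvexOn ℝ (Set.Ioi (0 : ℝ))
      (fun z : ℝ => Real.log ((1 / z) * Real.arctan (1 / z))) := by
  refine convexOn_of_hasDerivWithinAt2_nonneg (convex_Ioi 0)
    (fun x hx => (hasDerivAt_log_one_div_mul_arctan_one_div hx).continuousAt.continuousWithinAt)
    (fun x hx => (hasDerivAt_log_one_div_mul_arctan_one_div
      (interior_subset hx)).hasDerivWithinAt)
    (fun x hx => (hasDerivAt_neg_one_div_sub_one_div_mul_arctan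
      (interior_subset hx)).hasDerivWithinAt)
    (fun x hx => ?_)
  have hx : 0 < x := interior_subset hx
  have hA : 0 < arctan (1 / x) := arctan_pos.2 (one_div_pos.2 hx)
  have hle : x ≤ (1 + x ^ 2) * arctan (1 / x) := by
    have h := div_one_add_sq_le_arctan (one_div_pos.2 hx).le
    have he : 1 / x / (1 + (1 / x) ^ 2) = x / (1 + x ^ 2) := by
      field_simp
      ring
    rwa [he, div_le_iff₀' (by positivity)] at h
  generalize arctan (1 / x) = A at hA hle ⊢
  have hsq : x ^ 2 ≤ ((1 + x ^ 2) * A) ^ 2 := by gcongr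
  have hpos : 0 ≤ 2 * x * A * x ^ 2 := by positivity
  rw [div_add_div _ _ (by positivity) (by positivity)]
  refine div_nonneg ?_ (by positivity)
  linarith
end

section
/- (Lemma 1, complete monotonicity of φ₂) The function φ₂(z) = (1/√z)·arctan(1/√z) is completely monotone on (0, ∞): for every natural number n and every z > 0, (−1)ⁿ times the n-th derivative of φ₂ at z is nonnegative. -/
open Real

/-- The integral of `1 / (z + t²) ^ (k + 1)` over `t ∈ [0, 1]`. For `z > 0` it is `(-1) ^ k / k!`
times the `k`-th derivative of `z ↦ arctan (1 / √z) / √z`. -/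
noncomputable def integralInvAddSqPow (k : ℕ) (z : ℝ) : ℝ :=
  ∫ t in (0 : ℝ)..1, ((z + t ^ 2) ^ (k + 1))⁻¹

lemma continuous_inv_add_sq_pow (k : ℕ) {z : ℝ} (hz : 0 < z) :
    Continuous fun t : ℝ => ((z + t ^ 2) ^ (k + 1))⁻¹ :=
  Continuous.inv₀ (by fun_prop) fun t => by positivity

lemma integralInvAddSqPow_nonneg (k : ℕ) {z : ℝ} (hz : 0 < z) :
    0 ≤ integralInvAddSqPow k z :=
  intervalIntegral.integral_nonneg zero_le_one fun t _ => by positivity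

lemma hasDerivAt_inv_add_pow (k : ℕ) {x c : ℝ} (h : x + c ≠ 0) :
    HasDerivAt (fun y : ℝ => ((y + c) ^ (k + 1))⁻¹)
      (-(k + 1 : ℝ) * ((x + c) ^ (k + 1 + 1))⁻¹) x := by
  refine ((((hasDerivAt_id x).add_const c).pow (k + 1)).inv (pow_ne_zero _ h)).congr_deriv ?_
  simp only [id, Pi.pow_apply, Nat.cast_add, Nat.cast_one, Nat.add_sub_cancel]
  field_simp
  ring

lemma hasDerivAt_integralInvAddSqPow (k : ℕ) {z : ℝ} (hz : 0 < z) :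
    HasDerivAt (integralInvAddSqPow k) (-(k + 1 : ℝ) * integralInvAddSqPow (k + 1) z) z := by
  have hmem : Set.Ioi (z / 2) ∈ nhds z := Ioi_mem_nhds (by linarith)
  have hpos : ∀ x ∈ Set.Ioi (z / 2), 0 < x := fun x hx => by
    have := Set.mem_Ioi.1 hx
    linarith
  have h := (intervalIntegral.hasDerivAt_integral_of_dominated_loc_of_deriv_le
    (μ := MeasureTheory.volume) (a := 0) (b := 1)
    (F := fun x t : ℝ => ((x + t ^ 2) ^ (k + 1))⁻¹)
    (F' := fun x t : ℝ => -(k + 1 : ℝ) * ((x + t ^ 2) ^ (k + 1 + 1))⁻¹)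
    (bound := fun _ => (k + 1 : ℝ) * ((z / 2) ^ (k + 1 + 1))⁻¹)
    hmem ?_ ?_ ?_ ?_ ?_ ?_).2
  · rwa [intervalIntegral.integral_const_mul] at h
  · filter_upwards [hmem] with x hx
    exact (continuous_inv_add_sq_pow k (hpos x hx)).aestronglyMeasurable
  · exact (continuous_inv_add_sq_pow k hz).intervalIntegrable _ _
  · exact (continuous_const.mul (continuous_inv_add_sq_pow (k + 1) hz)).aestronglyMeasurable
  · refine Filter.Eventually.of_forall fun t _ x hx => ?_
    have hx0 := hpos x hx
    rw [norm_mul, norm_neg, Real.norm_of_nonneg (by positivity : (0 : ℝ) ≤ k + 1),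
      Real.norm_of_nonneg (by positivity)]
    gcongr
    nlinarith [Set.mem_Ioi.1 hx, sq_nonneg t]
  · exact intervalIntegrable_const
  · refine Filter.Eventually.of_forall fun t _ x hx => ?_
    have hx0 := hpos x hx
    exact hasDerivAt_inv_add_pow k (by positivity)

lemma one_div_sqrt_mul_arctan_eq_integral {z : ℝ} (hz : 0 < z) :
    1 / √z * arctan (1 / √z) = integralInvAddSqPow 0 z := by
  have h := integral_inv_sq_add_sq (a := 0) (b := 1) (Real.sqrt_pos.2 hz).ne'
  simp only [Real.sq_sqrt hz.le] at h
  simp [integralInvAddSqPow, h]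

lemma iteratedDeriv_one_div_sqrt_mul_arctan (n : ℕ) {z : ℝ} (hz : 0 < z) :
    iteratedDeriv n (fun z : ℝ => 1 / √z * arctan (1 / √z)) z =
      (-1) ^ n * n.factorial * integralInvAddSqPow n z := by
  induction n generalizing z with
  | zero => simpa using one_div_sqrt_mul_arctan_eq_integral hz
  | succ n ih =>
    have heq : iteratedDeriv n (fun z : ℝ => 1 / √z * arctan (1 / √z)) =ᶠ[nhds z]
        fun x => (-1) ^ n * n.factorial * integralInvAddSqPow n x := by
      filter_upwards [Ioi_mem_nhds hz] with x hx using ih hx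
    rw [iteratedDeriv_succ, heq.deriv_eq,
      ((hasDerivAt_integralInvAddSqPow n hz).const_mul _).deriv, Nat.factorial_succ]
    push_cast
    ring

/-- **Lemma 1 (complete monotonicity of `φ₂`).** The function
`φ₂(z) = (1/√z)·arctan(1/√z)` is completely monotone on `(0, ∞)`: for every natural
number `n` and every `z > 0`, `(−1)ⁿ` times the `n`-th derivative of `φ₂` at `z`
is nonnegative. -/
theorem phi2_completelyMonotone :
    ∀ (n : ℕ) (z : ℝ), 0 < z →
      0 ≤ (-1 : ℝ) ^ n *
        iteratedDeriv n
          (fun z : ℝ => (1 / Real.sqrt z) * Real.arctan (1 / Real.sqrt z)) z := by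
  intro n z hz
  rw [iteratedDeriv_one_div_sqrt_mul_arctan n hz, ← mul_assoc, ← mul_assoc, ← mul_pow]
  norm_num
  exact mul_nonneg (Nat.cast_nonneg _) (integralInvAddSqPow_nonneg n hz)
end

section
/- Let β > 0 and c > 0. Then π/√(c·(4c + π²·β)) < μ(c, β) < (π/(4β))·(√(1 + 4β/c) − 1). -/
open Real

theorem mul_sin_lt_mul_sin {d a : ℝ} (hd : 0 < d) (hda : d < a) (ha : a ≤ π) :
    d * sin a < a * sin d := by
  have ha0 : 0 < a := hd.trans hda
  have hu : 0 < 1 - d / a := by rwa [sub_pos, div_lt_one ha0]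
  have h := strictConcaveOn_sin_Icc.2 (⟨le_rfl, pi_pos.le⟩ : (0 : ℝ) ∈ Set.Icc 0 π)
    ⟨ha0.le, ha⟩ ha0.ne hu (div_pos hd ha0) (sub_add_cancel 1 (d / a))
  simp only [smul_eq_mul, sin_zero, mul_zero, zero_add, div_mul_cancel₀ _ ha0.ne'] at h
  rw [div_mul_eq_mul_div, div_lt_iff₀ ha0] at h
  linarith

/-- `tan x / x` is strictly increasing on `(0, π / 2)`, in a division-free form. -/
theorem mul_sin_mul_cos_lt {x y : ℝ} (hx : 0 < x) (hxy : x < y) (hy : y < π / 2) :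
    y * (sin x * cos y) < x * (cos x * sin y) := by
  have h := mul_sin_lt_mul_sin (d := y - x) (a := y + x) (by linarith) (by linarith)
    (by linarith)
  rw [sin_add, sin_sub] at h
  linarith

/-- The upper Becker–Stark inequality, in a division-free form. -/
theorem sq_sub_mul_sin_lt {x : ℝ} (hx : 0 < x) (hx' : x < π / 2) :
    (π ^ 2 - 4 * x ^ 2) * sin x < π ^ 2 * x * cos x := by
  let f : ℝ → ℝ := fun t => π ^ 2 * t * cos t - (π ^ 2 - 4 * t ^ 2) * sin t
  have hf : ∀ t, HasDerivAt f (t * (4 * t * cos t - (π ^ 2 - 8) * sin t)) t := fun t => by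
    have h := (((hasDerivAt_id' t).const_mul (π ^ 2)).mul (hasDerivAt_cos t)).sub
      ((((hasDerivAt_pow 2 t).const_mul 4).const_sub (π ^ 2)).mul (hasDerivAt_sin t))
    exact h.congr_deriv (by push_cast; ring)
  have hfc : Continuous f := continuous_iff_continuousAt.2 fun t => (hf t).continuousAt
  have hf0 : f 0 = 0 := by simp [f]
  have hf1 : f (π / 2) = 0 := by simp [f]; ring
  by_contra! hneg
  have hfx : f x ≤ 0 := sub_nonpos.2 hneg
  obtain ⟨a, ⟨ha0, hax⟩, ha⟩ := exists_hasDerivAt_eq_slope f _ hx hfc.continuousOn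
    fun t _ => hf t
  obtain ⟨b, ⟨hxb, hb1⟩, hb⟩ := exists_hasDerivAt_eq_slope f _ hx' hfc.continuousOn
    fun t _ => hf t
  have ha' : 4 * a * cos a - (π ^ 2 - 8) * sin a ≤ 0 := by
    refine nonpos_of_mul_nonpos_right (ha.trans_le ?_) ha0
    exact div_nonpos_of_nonpos_of_nonneg (by linarith) (by linarith)
  have hb' : 0 ≤ 4 * b * cos b - (π ^ 2 - 8) * sin b := by
    refine nonneg_of_mul_nonneg_right ((div_nonneg ?_ ?_).trans_eq hb.symm) (by linarith) <;>
      linarith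
  have hab := mul_sin_mul_cos_lt ha0 (hax.trans hxb) hb1
  have hsin : 0 < sin a := sin_pos_of_pos_of_lt_pi ha0 (by linarith)
  have hcos : 0 < cos a := cos_pos_of_mem_Ioo ⟨by linarith, by linarith⟩
  have hsin' : 0 < sin b := sin_pos_of_pos_of_lt_pi (by linarith) (by linarith)
  have h1 := mul_le_mul_of_nonneg_right (sub_nonpos.1 ha') hsin'.le
  have h2 := mul_le_mul_of_nonneg_right (sub_nonneg.1 hb') hsin.le
  linarith

theorem mul_cos_lt_mul_sin {x : ℝ} (hx : 0 < x) (hx' : x < π / 2) :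
    4 * x * cos x < π * (π - 2 * x) * sin x := by
  have h1 : 2 / π * x < sin x := mul_lt_sin hx hx'
  have h2 : cos x < π / 2 - x := by
    rw [← sin_pi_div_two_sub]
    exact sin_lt (by linarith)
  rw [div_mul_eq_mul_div, div_lt_iff₀ pi_pos] at h1
  nlinarith

theorem mu_bounds (β c μ : ℝ) (hβ : 0 < β) (hc : 0 < c)
    (hμ : μ ∈ Set.Ioo 0 (π / (2 * c)) ∧ μ * Real.tan (μ * c) = 1 / β) :
    π / Real.sqrt (c * (4 * c + π ^ 2 * β)) < μ ∧
      μ < (π / (4 * β)) * (Real.sqrt (1 + 4 * β / c) - 1) := by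
  obtain ⟨⟨hμ0, hμ1⟩, htan⟩ := hμ
  have hπ := pi_pos
  have hx : 0 < μ * c := mul_pos hμ0 hc
  have hx' : μ * c < π / 2 := by
    rw [lt_div_iff₀ (by positivity)] at hμ1
    linarith
  have hcos : 0 < cos (μ * c) := cos_pos_of_mem_Ioo ⟨by linarith, hx'⟩
  have hsc : cos (μ * c) = β * μ * sin (μ * c) := by
    rw [tan_eq_sin_div_cos] at htan
    field_simp at htan
    linarith
  have hsin : 0 < sin (μ * c) := sin_pos_of_pos_of_lt_pi hx (by linarith)
  have hlow := sq_sub_mul_sin_lt hx hx'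
  have hupp := mul_cos_lt_mul_sin hx hx'
  rw [hsc, ← mul_assoc] at hlow hupp
  replace hlow := lt_of_mul_lt_mul_right hlow hsin.le
  replace hupp := lt_of_mul_lt_mul_right hupp hsin.le
  constructor
  · rw [div_lt_comm₀ (by positivity) hμ0]
    refine lt_sqrt_of_sq_lt ?_
    rw [div_pow, div_lt_iff₀ (by positivity)]
    linarith
  · have hsqrt : 1 + 4 * β * μ / π < √(1 + 4 * β / c) := by
      refine lt_sqrt_of_sq_lt ?_
      rw [← sub_pos]
      have : 1 + 4 * β / c - (1 + 4 * β * μ / π) ^ 2 =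
          4 * β / (c * π ^ 2) * (π * (π - 2 * (μ * c)) - 4 * (μ * c) * (β * μ)) := by
        field_simp
        ring
      rw [this]
      exact mul_pos (by positivity) (sub_pos.2 hupp)
    calc μ = π / (4 * β) * (1 + 4 * β * μ / π - 1) := by field_simp; ring
      _ < _ := by gcongr
end

section
/- Let β > 0 and h > 0, and let λ_□ = 2·μ(h, β)² be the fundamental Robin eigenvalue of the square (−h, h) × (−h, h). Then λ_□ > 2/(h·β) − 2/β². -/
open Real

/-- Let `β > 0` and `h > 0`, and let `λ_□ = 2·μ(h, β)²` be the fundamental Robin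
eigenvalue of the square `(−h, h) × (−h, h)`, where `μ(h, β)` is the unique number in
`(0, π/(2h))` with `μ · tan(μ·h) = 1/β`.  Then `λ_□ > 2/(h·β) − 2/β²`. -/
theorem lambda_square_lower_bound (β h μ : ℝ) (hβ : 0 < β) (hh : 0 < h)
    (hμ : μ ∈ Set.Ioo 0 (π / (2 * h)) ∧ μ * Real.tan (μ * h) = 1 / β) :
    2 * μ ^ 2 > 2 / (h * β) - 2 / β ^ 2 := by
  obtain ⟨⟨hμ0, hμ1⟩, hroot⟩ := hμ
  have hx0 : 0 < μ * h := mul_pos hμ0 hh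
  have hx1 : μ * h < π / 2 := by
    rw [lt_div_iff₀ (by positivity)] at hμ1
    linarith
  have hcos : 0 < Real.cos (μ * h) :=
    Real.cos_pos_of_mem_Ioo ⟨by linarith [Real.pi_pos], hx1⟩
  have hsin : 0 < Real.sin (μ * h) :=
    Real.sin_pos_of_pos_of_lt_pi hx0 (by linarith [Real.pi_pos])
  have hkey : Real.sin (μ * h) * Real.cos (μ * h) < μ * h :=
    (mul_le_of_le_one_right hsin.le (Real.cos_le_one _)).trans_lt (Real.sin_lt hx0)
  have hrhs : 2 / (h * β) - 2 / β ^ 2 = 2 * (1 / β) / h - 2 * (1 / β) ^ 2 := by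
    field_simp
  have hdiff : 2 * μ ^ 2 - (2 / (h * β) - 2 / β ^ 2) =
      2 * μ / (h * Real.cos (μ * h) ^ 2) *
        (μ * h - Real.sin (μ * h) * Real.cos (μ * h)) := by
    rw [hrhs, ← hroot, Real.tan_eq_sin_div_cos]
    have hsq := Real.sin_sq_add_cos_sq (μ * h)
    generalize Real.sin (μ * h) = s at *
    generalize Real.cos (μ * h) = c at *
    field_simp
    linear_combination (μ * h) * hsq
  have hpos : 0 < 2 * μ / (h * Real.cos (μ * h) ^ 2) *
      (μ * h - Real.sin (μ * h) * Real.cos (μ * h)) :=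
    mul_pos (by positivity) (sub_pos.mpr hkey)
  linarith
end

section
/- Let β > 0 and h > 0. For every r > 0, μ(r·h, β) + μ(h/r, β) ≥ 2·μ(h, β), with strict inequality when r ≠ 1. (This is a strengthening of the inequality μ(rh, β)² + μ(h/r, β)² ≥ 2·μ(h, β)² of Theorem 3.) -/
open Real

/-- `sin² x / x + tan x` is strictly increasing on `(0, π / 2)`. -/
lemma strictMonoOn_sin_sq_div_add_tan :
    StrictMonoOn (fun x : ℝ => sin x ^ 2 / x + tan x) (Set.Ioo 0 (π / 2)) := by
  have hd : ∀ x ∈ Set.Ioo 0 (π / 2), HasDerivAt (fun x : ℝ => sin x ^ 2 / x + tan x)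
      ((2 * sin x * cos x * x - sin x ^ 2) / x ^ 2 + 1 / cos x ^ 2) x := by
    intro x hx
    have hc : 0 < cos x := cos_pos_of_mem_Ioo ⟨by linarith [hx.1, pi_pos], hx.2⟩
    refine ((((hasDerivAt_sin x).pow 2).div (hasDerivAt_id x) hx.1.ne').add
      (hasDerivAt_tan hc.ne')).congr_deriv ?_
    simp
  refine strictMonoOn_of_deriv_pos (convex_Ioo _ _)
    (fun x hx => (hd x hx).continuousAt.continuousWithinAt) fun x hx => ?_
  rw [interior_Ioo] at hx
  rw [(hd x hx).deriv]
  have hx0 : 0 < x := hx.1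
  have hc : 0 < cos x := cos_pos_of_mem_Ioo ⟨by linarith [pi_pos], hx.2⟩
  have hs : 0 < sin x := sin_pos_of_pos_of_lt_pi hx0 (by linarith [hx.2, pi_pos])
  have h1 : sin x ^ 2 / x ^ 2 < 1 := by
    rw [div_lt_one (by positivity)]
    exact pow_lt_pow_left₀ (sin_lt hx0) hs.le two_ne_zero
  have h2 : 1 ≤ 1 / cos x ^ 2 := by
    rw [le_div_iff₀ (by positivity)]
    nlinarith [cos_sq_add_sin_sq x, sq_nonneg (sin x)]
  have h3 : 0 < 2 * sin x * cos x * x / x ^ 2 := by positivity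
  rw [sub_div]
  linarith

/-- With `L = log (x tan x)`, the function `cot x` lies strictly above its tangent line, as a
function of `L`, at `s`. -/
lemma cos_div_sin_add_log_lt {s x : ℝ} (hs : s ∈ Set.Ioo 0 (π / 2))
    (hx : x ∈ Set.Ioo 0 (π / 2)) (hne : x ≠ s) :
    cos s / sin s + (sin s ^ 2 / s + tan s)⁻¹ * log (s * tan s) <
      cos x / sin x + (sin s ^ 2 / s + tan s)⁻¹ * log (x * tan x) := by
  have hG : 0 < sin s ^ 2 / s + tan s :=
    add_pos_of_nonneg_of_pos (div_nonneg (sq_nonneg _) hs.1.le)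
      (tan_pos_of_pos_of_lt_pi_div_two hs.1 hs.2)
  set c := (sin s ^ 2 / s + tan s)⁻¹ with hc
  have hd : ∀ y ∈ Set.Ioo 0 (π / 2),
      0 < sin y ∧ HasDerivAt (fun y : ℝ => cos y / sin y + c * log (y * tan y))
      ((c * (sin y ^ 2 / y + tan y) - 1) / sin y ^ 2) y := by
    intro y hy
    have hy0 : 0 < y := hy.1
    have hcos : 0 < cos y := cos_pos_of_mem_Ioo ⟨by linarith [pi_pos], hy.2⟩
    have hsin : 0 < sin y := sin_pos_of_pos_of_lt_pi hy0 (by linarith [hy.2, pi_pos])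
    have htan : 0 < tan y := tan_pos_of_pos_of_lt_pi_div_two hy.1 hy.2
    refine ⟨hsin, ?_⟩
    refine (((hasDerivAt_cos y).div (hasDerivAt_sin y) hsin.ne').add
      ((((hasDerivAt_id y).mul (hasDerivAt_tan hcos.ne')).log
        (mul_pos hy0 htan).ne').const_mul c)).congr_deriv ?_
    simp only [id, Pi.mul_apply, tan_eq_sin_div_cos]
    have h1 : cos y ^ 2 = 1 - sin y ^ 2 := cos_sq' y
    field_simp
    grind
  rcases hne.lt_or_gt with h | h
  · have hsub : Set.Icc x s ⊆ Set.Ioo 0 (π / 2) := fun y hy =>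
      ⟨hx.1.trans_le hy.1, hy.2.trans_lt hs.2⟩
    refine strictAntiOn_of_deriv_neg (convex_Icc x s)
      (fun y hy => (hd y (hsub hy)).2.continuousAt.continuousWithinAt) (fun y hy => ?_)
      (Set.left_mem_Icc.2 h.le) (Set.right_mem_Icc.2 h.le) h
    rw [interior_Icc] at hy
    obtain ⟨hsin, hder⟩ := hd y (hsub (Set.Ioo_subset_Icc_self hy))
    rw [hder.deriv]
    refine div_neg_of_neg_of_pos ?_ (by positivity)
    rw [sub_neg, hc, inv_mul_lt_one₀ hG]
    exact strictMonoOn_sin_sq_div_add_tan (hsub (Set.Ioo_subset_Icc_self hy)) hs hy.2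
  · have hsub : Set.Icc s x ⊆ Set.Ioo 0 (π / 2) := fun y hy =>
      ⟨hs.1.trans_le hy.1, hy.2.trans_lt hx.2⟩
    refine strictMonoOn_of_deriv_pos (convex_Icc s x)
      (fun y hy => (hd y (hsub hy)).2.continuousAt.continuousWithinAt) (fun y hy => ?_)
      (Set.left_mem_Icc.2 h.le) (Set.right_mem_Icc.2 h.le) h
    rw [interior_Icc] at hy
    obtain ⟨hsin, hder⟩ := hd y (hsub (Set.Ioo_subset_Icc_self hy))
    rw [hder.deriv]
    refine div_pos ?_ (by positivity)
    rw [sub_pos, hc, one_lt_inv_mul₀ hG]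
    exact strictMonoOn_sin_sq_div_add_tan hs (hsub (Set.Ioo_subset_Icc_self hy)) hy.1

/-- The angle `m * c` of a solution of `m * tan (m * c) = k` lies in `(0, π / 2)` and
parametrizes both `m` and `c`. -/
lemma mul_mem_Ioo_and_eq_of_mul_tan_eq {m c k : ℝ} (hc : 0 < c)
    (hm : m ∈ Set.Ioo 0 (π / (2 * c))) (h : m * tan (m * c) = k) :
    m * c ∈ Set.Ioo 0 (π / 2) ∧ m = k * (cos (m * c) / sin (m * c)) ∧
      m * c * tan (m * c) = k * c := by
  have hlt : m * c < π / 2 := by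
    have := (lt_div_iff₀ (by positivity)).1 hm.2
    linarith
  have h0 : 0 < m * c := mul_pos hm.1 hc
  have hcos : 0 < cos (m * c) := cos_pos_of_mem_Ioo ⟨by linarith [pi_pos], hlt⟩
  have hsin : 0 < sin (m * c) := sin_pos_of_pos_of_lt_pi h0 (by linarith [pi_pos])
  refine ⟨⟨h0, hlt⟩, ?_, by rw [← h]; ring⟩
  rw [← h, tan_eq_sin_div_cos]
  field_simp


/-- Let `β > 0` and `h > 0`.  For every `r > 0`, with `μ(c, β)` the unique number in
`(0, π/(2c))` satisfying `μ · tan(μ·c) = 1/β`, one has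
`μ(r·h, β) + μ(h/r, β) ≥ 2·μ(h, β)`, with strict inequality when `r ≠ 1`.
(This strengthens the inequality `μ(rh, β)² + μ(h/r, β)² ≥ 2·μ(h, β)²` of Theorem 3.) -/
theorem mu_sum_ge_two_mu_square (β h r : ℝ) (hβ : 0 < β) (hh : 0 < h) (hr : 0 < r)
    (μX μY μS : ℝ)
    (hX : μX ∈ Set.Ioo 0 (π / (2 * (r * h))) ∧ μX * Real.tan (μX * (r * h)) = 1 / β)
    (hY : μY ∈ Set.Ioo 0 (π / (2 * (h / r))) ∧ μY * Real.tan (μY * (h / r)) = 1 / β)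
    (hS : μS ∈ Set.Ioo 0 (π / (2 * h)) ∧ μS * Real.tan (μS * h) = 1 / β) :
    μX + μY ≥ 2 * μS ∧ (r ≠ 1 → μX + μY > 2 * μS) := by
  obtain ⟨hXm, hXe, hXt⟩ := mul_mem_Ioo_and_eq_of_mul_tan_eq (by positivity) hX.1 hX.2
  obtain ⟨hYm, hYe, hYt⟩ := mul_mem_Ioo_and_eq_of_mul_tan_eq (by positivity) hY.1 hY.2
  obtain ⟨hSm, hSe, hSt⟩ := mul_mem_Ioo_and_eq_of_mul_tan_eq hh hS.1 hS.2
  have hk : 0 < 1 / β := by positivity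
  have hlog : log (1 / β * (r * h)) + log (1 / β * (h / r)) = 2 * log (1 / β * h) := by
    rw [← log_mul (by positivity) (by positivity),
      show 1 / β * (r * h) * (1 / β * (h / r)) = (1 / β * h) ^ 2 by field_simp, log_pow]
    norm_num
  have key : ∀ {m d : ℝ}, m * d ∈ Set.Ioo 0 (π / 2) → m = 1 / β * (cos (m * d) / sin (m * d)) →
      m * d * tan (m * d) = 1 / β * d → m * d ≠ μS * h →
      μS + 1 / β * ((sin (μS * h) ^ 2 / (μS * h) + tan (μS * h))⁻¹ * log (1 / β * h)) <
        m + 1 / β * ((sin (μS * h) ^ 2 / (μS * h) + tan (μS * h))⁻¹ * log (1 / β * d)) := by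
    intro m d hm he ht hd
    have hlt := cos_div_sin_add_log_lt hSm hm hd
    rw [hSt, ht] at hlt
    have := mul_lt_mul_of_pos_left hlt hk
    rwa [mul_add, mul_add, ← he, ← hSe] at this
  have hstrict : r ≠ 1 → μX + μY > 2 * μS := by
    intro hr1
    have h1 := key hXm hXe hXt fun e => hr1 <| by
      rw [e, hSt] at hXt
      field_simp at hXt
      exact hXt.symm
    have h2 := key hYm hYe hYt fun e => hr1 <| by
      rw [e, hSt] at hYt
      field_simp at hYt
      exact hYt
    set c := (sin (μS * h) ^ 2 / (μS * h) + tan (μS * h))⁻¹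
    linear_combination h1 + h2 + 1 / β * c * hlog
  refine ⟨?_, hstrict⟩
  rcases eq_or_ne r 1 with rfl | hr1
  · have hle : ∀ {m : ℝ}, m * h ∈ Set.Ioo 0 (π / 2) →
        m = 1 / β * (cos (m * h) / sin (m * h)) → m * h * tan (m * h) = 1 / β * h → μS ≤ m := by
      intro m hm he ht
      by_cases heq : m * h = μS * h
      · exact (mul_right_cancel₀ hh.ne' heq).ge
      · exact (lt_of_add_lt_add_right (key hm he ht heq)).le
    rw [one_mul] at hXm hXe hXt
    rw [div_one] at hYm hYe hYt
    linarith [hle hXm hXe hXt, hle hYm hYe hYt]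
  · exact (hstrict hr1).le
end

section
/- Let β > 0 and h > 0. For every r > 0, μ(r·h, β)² + μ(h/r, β)² ≤ ((r² + 1/r²)/2) · (2·μ(h, β)²); that is, the fundamental Robin eigenvalue λ₁(r) of the rectangle (−rh, rh) × (−h/r, h/r) satisfies λ₁(r) ≤ (λ_□/2)·(r² + 1/r²), where λ_□ = 2·μ(h, β)² is the fundamental Robin eigenvalue of the square of the same area, with equality when β = 0. -/
open Real

/-- The graph of `tan` on `(0, π/2)` lies above its tangent lines. -/
lemma tan_tangent_le {u v : ℝ} (hu : u ∈ Set.Ioo 0 (π / 2)) (hv : v ∈ Set.Ioo 0 (π / 2)) :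
    tan u + (v - u) / cos u ^ 2 ≤ tan v := by
  have hcos : ∀ x ∈ Set.Ioo 0 (π / 2), 0 < cos x := fun x hx =>
    cos_pos_of_mem_Ioo ⟨by linarith [hx.1, pi_pos], hx.2⟩
  have slope : ∀ a ∈ Set.Ioo 0 (π / 2), ∀ b ∈ Set.Ioo 0 (π / 2), a < b →
      ∃ c ∈ Set.Ioo a b, 1 / cos c ^ 2 = (tan b - tan a) / (b - a) := by
    intro a ha b hb hab
    have hd : ∀ x ∈ Set.Icc a b, HasDerivAt tan (1 / cos x ^ 2) x := fun x hx =>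
      hasDerivAt_tan (hcos x ⟨by linarith [ha.1, hx.1], by linarith [hb.2, hx.2]⟩).ne'
    exact exists_hasDerivAt_eq_slope tan _ hab
      (fun x hx => (hd x hx).continuousAt.continuousWithinAt)
      (fun x hx => hd x ⟨hx.1.le, hx.2.le⟩)
  have mono : ∀ a ∈ Set.Ioo 0 (π / 2), ∀ b ∈ Set.Ioo 0 (π / 2), a < b →
      1 / cos a ^ 2 ≤ 1 / cos b ^ 2 := by
    intro a ha b hb hab
    have h1 : cos b < cos a :=
      cos_lt_cos_of_nonneg_of_le_pi_div_two ha.1.le hb.2.le hab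
    have h2 := hcos b hb
    gcongr
  rcases lt_trichotomy u v with h | h | h
  · obtain ⟨c, hc, he⟩ := slope u hu v hv h
    have h1 := mono u hu c ⟨by linarith [hu.1, hc.1], by linarith [hv.2, hc.2]⟩ hc.1
    rw [he, le_div_iff₀ (sub_pos.2 h)] at h1
    have h2 : (v - u) / cos u ^ 2 = 1 / cos u ^ 2 * (v - u) := by ring
    linarith
  · simp [h]
  · obtain ⟨c, hc, he⟩ := slope v hv u hu h
    have h1 := mono c ⟨by linarith [hv.1, hc.1], by linarith [hu.2, hc.2]⟩ u hu hc.2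
    rw [he, div_le_iff₀ (sub_pos.2 h)] at h1
    have h2 : (v - u) / cos u ^ 2 = -(1 / cos u ^ 2 * (u - v)) := by ring
    linarith

/-- The tangent-line inequality expressing that `√s * tan √s` is convex in `s`. -/
lemma mul_tan_tangent_le {u v : ℝ} (hu : u ∈ Set.Ioo 0 (π / 2))
    (hv : v ∈ Set.Ioo 0 (π / 2)) :
    u * tan u + (tan u / u + 1 / cos u ^ 2) / 2 * (v ^ 2 - u ^ 2) ≤ v * tan v := by
  have hc : 0 < cos u := cos_pos_of_mem_Ioo ⟨by linarith [hu.1, pi_pos], hu.2⟩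
  have h0 := hu.1
  have hslope : tan u / u ≤ 1 / cos u ^ 2 := by
    rw [tan_eq_sin_div_cos, div_div, div_le_div_iff₀ (by positivity) (by positivity)]
    have h1 : sin u * cos u ≤ u := by
      have := sin_le (by linarith : 0 ≤ 2 * u)
      rw [sin_two_mul] at this
      linarith
    nlinarith
  have h2 := mul_le_mul_of_nonneg_left (tan_tangent_le hu hv) hv.1.le
  have h3 := mul_nonneg (sq_nonneg (v - u)) (sub_nonneg.2 hslope)
  have h4 : v * (tan u + (v - u) / cos u ^ 2)
      - (u * tan u + (tan u / u + 1 / cos u ^ 2) / 2 * (v ^ 2 - u ^ 2))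
      = (v - u) ^ 2 * (1 / cos u ^ 2 - tan u / u) / 2 := by
    field_simp
    ring
  linarith

/-- Rescaling a solution of the transcendental equation to the interval `(0, π / 2)`. -/
lemma robin_rescale {β c μ : ℝ} (hc : 0 < c)
    (h : μ ∈ Set.Ioo 0 (π / (2 * c)) ∧ μ * tan (μ * c) = 1 / β) :
    μ * c ∈ Set.Ioo 0 (π / 2) ∧ μ * c * tan (μ * c) = c / β := by
  obtain ⟨⟨h0, h1⟩, h2⟩ := h
  refine ⟨⟨by positivity, ?_⟩, ?_⟩
  · rw [lt_div_iff₀ (by positivity)] at h1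
    linarith
  · linear_combination c * h2

/-- Let `β > 0` and `h > 0`.  For every `r > 0`, with `μ(c, β)` the unique number in
`(0, π/(2c))` satisfying `μ · tan(μ·c) = 1/β`, the fundamental Robin eigenvalue
`λ₁(r) = μ(rh, β)² + μ(h/r, β)²` of the rectangle `(−rh, rh) × (−h/r, h/r)` satisfies
`λ₁(r) ≤ (λ_□/2)·(r² + 1/r²)`, where `λ_□ = 2·μ(h, β)²` is the fundamental Robin
eigenvalue of the square of the same area (with equality when `β = 0`). -/
theorem lambda1_rectangle_upper_bound (β h r : ℝ) (hβ : 0 < β) (hh : 0 < h) (hr : 0 < r)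
    (μX μY μS : ℝ)
    (hX : μX ∈ Set.Ioo 0 (π / (2 * (r * h))) ∧ μX * Real.tan (μX * (r * h)) = 1 / β)
    (hY : μY ∈ Set.Ioo 0 (π / (2 * (h / r))) ∧ μY * Real.tan (μY * (h / r)) = 1 / β)
    (hS : μS ∈ Set.Ioo 0 (π / (2 * h)) ∧ μS * Real.tan (μS * h) = 1 / β) :
    μX ^ 2 + μY ^ 2 ≤ ((r ^ 2 + 1 / r ^ 2) / 2) * (2 * μS ^ 2) := by
  obtain ⟨hx, hxe⟩ := robin_rescale (mul_pos hr hh) hX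
  obtain ⟨hy, hye⟩ := robin_rescale (div_pos hh hr) hY
  obtain ⟨hs, hse⟩ := robin_rescale hh hS
  have tx := mul_tan_tangent_le hs hx
  have ty := mul_tan_tangent_le hs hy
  have hμ := hs.1
  have hc : 0 < cos (μS * h) := cos_pos_of_mem_Ioo ⟨by linarith [pi_pos], hs.2⟩
  have ht : 0 < tan (μS * h) := tan_pos_of_pos_of_lt_pi_div_two hμ hs.2
  rw [hxe, hse] at tx
  rw [hye, hse] at ty
  set D := (tan (μS * h) / (μS * h) + 1 / cos (μS * h) ^ 2) / 2
  have hD : 0 < D := by positivity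
  have ex : D * (μX ^ 2 - μS ^ 2 / r ^ 2) ≤ (r - 1) / r ^ 2 / (β * h) := by
    have e : (r - 1) / r ^ 2 / (β * h) - D * (μX ^ 2 - μS ^ 2 / r ^ 2)
        = (r * h / β - (h / β + D * ((μX * (r * h)) ^ 2 - (μS * h) ^ 2))) / (r * h) ^ 2 := by
      field_simp
      ring
    have := div_nonneg (sub_nonneg.2 tx) (sq_nonneg (r * h))
    linarith
  have ey : D * (μY ^ 2 - r ^ 2 * μS ^ 2) ≤ (r - r ^ 2) / (β * h) := by
    have e : (r - r ^ 2) / (β * h) - D * (μY ^ 2 - r ^ 2 * μS ^ 2)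
        = (h / r / β - (h / β + D * ((μY * (h / r)) ^ 2 - (μS * h) ^ 2))) / (h / r) ^ 2 := by
      field_simp
      ring
    have := div_nonneg (sub_nonneg.2 ty) (sq_nonneg (h / r))
    linarith
  have hsum : (r - 1) / r ^ 2 / (β * h) + (r - r ^ 2) / (β * h) ≤ 0 := by
    have e : (r - 1) / r ^ 2 / (β * h) + (r - r ^ 2) / (β * h)
        = -((r - 1) ^ 2 * (r ^ 2 + r + 1) / (r ^ 2 * (β * h))) := by
      field_simp
      ring
    rw [e]
    exact neg_nonpos.2 (by positivity)
  have key : μX ^ 2 - μS ^ 2 / r ^ 2 + (μY ^ 2 - r ^ 2 * μS ^ 2) ≤ 0 := by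
    refine nonpos_of_mul_nonpos_right (a := D) ?_ hD
    linarith
  have e : (r ^ 2 + 1 / r ^ 2) / 2 * (2 * μS ^ 2) = μS ^ 2 / r ^ 2 + r ^ 2 * μS ^ 2 := by ring
  linarith
end

section
/- Let Ω ⊆ ℝ² be a bounded measurable set of positive area |Ω|, with centroid z_c = (1/|Ω|)·∫_Ω z dz, polar moment of inertia I_c(Ω) = ∫_Ω ‖z − z_c‖² dz, and Fraenkel modulus of asymmetry α(Ω) = inf over z ∈ ℝ² of |Ω \ D_z|/|Ω|, where D_z is the disk of center z and area |Ω|. Then I_c(Ω) ≥ (|Ω|²/(2π)) · (1 + 2·α(Ω)²). -/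
open Real MeasureTheory

/-- The polar moment of inertia of a disk of radius `s` about its center is `π s⁴ / 2`. -/
theorem integral_closedBall_norm_sub_sq (c : EuclideanSpace ℝ (Fin 2)) {s : ℝ} (hs : 0 ≤ s) :
    ∫ z in Metric.closedBall c s, ‖z - c‖ ^ 2 = π * s ^ 4 / 2 := by
  have h1 : ∫ z in Metric.closedBall c s, ‖z - c‖ ^ 2
      = ∫ z : EuclideanSpace ℝ (Fin 2), (Set.Iic s).indicator (fun r : ℝ => r ^ 2) ‖z‖ := by
    rw [← integral_indicator Metric.isClosed_closedBall.measurableSet,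
      ← integral_sub_right_eq_self
        (fun z : EuclideanSpace ℝ (Fin 2) => (Set.Iic s).indicator (fun r : ℝ => r ^ 2) ‖z‖) c]
    refine integral_congr_ae (Filter.Eventually.of_forall fun z => ?_)
    classical
    simp only [Set.indicator_apply, mem_closedBall_iff_norm, Set.mem_Iic]
  have h2 : ∫ y in Set.Ioi (0 : ℝ), y ^ 1 • (Set.Iic s).indicator (fun r : ℝ => r ^ 2) y
      = s ^ 4 / 4 := by
    have h3 : ∀ y : ℝ, y ^ 1 • (Set.Iic s).indicator (fun r : ℝ => r ^ 2) y
        = (Set.Iic s).indicator (fun r : ℝ => r ^ 3) y := by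
      intro y
      by_cases hy : y ≤ s
      · simp [hy]; ring
      · simp [hy]
    simp_rw [h3]
    rw [setIntegral_indicator measurableSet_Iic, Set.Ioi_inter_Iic,
      ← intervalIntegral.integral_of_le hs, integral_pow]
    norm_num
  have h4 : (volume : Measure (EuclideanSpace ℝ (Fin 2))).real (Metric.ball 0 1) = π := by
    rw [measureReal_def, EuclideanSpace.volume_ball_fin_two]
    simp [pi_nonneg]
  rw [h1, integral_fun_norm_addHaar volume]
  simp only [finrank_euclideanSpace, Fintype.card_fin, Nat.add_one_sub_one]
  rw [h2, h4]
  simp only [nsmul_eq_mul, smul_eq_mul]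
  push_cast
  ring

theorem volume_real_closedBall_fin_two (c : EuclideanSpace ℝ (Fin 2)) {s : ℝ} (hs : 0 ≤ s) :
    volume.real (Metric.closedBall c s) = π * s ^ 2 := by
  rw [measureReal_def, EuclideanSpace.volume_closedBall_fin_two]
  simp [pi_nonneg, hs, mul_comm]

theorem Bornology.IsBounded.integrableOn_norm_sub_sq {S : Set (EuclideanSpace ℝ (Fin 2))}
    (hS : Bornology.IsBounded S) (c : EuclideanSpace ℝ (Fin 2)) :
    IntegrableOn (fun z : EuclideanSpace ℝ (Fin 2) => ‖z - c‖ ^ 2) S := by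
  obtain ⟨r, hr⟩ := hS.subset_closedBall c
  exact (ContinuousOn.integrableOn_compact (isCompact_closedBall c r)
    (by fun_prop)).mono_set hr

/-- Among bounded sets of given area, the polar moment of inertia about a point is smallest
for the disk centered at that point. -/
theorem sq_volume_div_two_pi_le_integral_norm_sub_sq {S : Set (EuclideanSpace ℝ (Fin 2))} (hS : MeasurableSet S)
    (hb : Bornology.IsBounded S) (c : EuclideanSpace ℝ (Fin 2)) :
    volume.real S ^ 2 / (2 * π) ≤ ∫ z in S, ‖z - c‖ ^ 2 := by
  set s : ℝ := √(volume.real S / π) with hs_def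
  have hs : 0 ≤ s := Real.sqrt_nonneg _
  have hs2 : π * s ^ 2 = volume.real S := by
    rw [hs_def, Real.sq_sqrt (by positivity)]
    field_simp
  set B := Metric.closedBall c s with hB
  have hBm : MeasurableSet B := Metric.isClosed_closedBall.measurableSet
  have hBb : Bornology.IsBounded B := Metric.isBounded_closedBall
  have hf : ∀ {T : Set (EuclideanSpace ℝ (Fin 2))}, Bornology.IsBounded T →
      IntegrableOn (fun z : EuclideanSpace ℝ (Fin 2) => ‖z - c‖ ^ 2 - s ^ 2) T := fun hT =>
    (hT.integrableOn_norm_sub_sq c).sub (integrableOn_const hT.measure_lt_top.ne)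
  have hval : ∀ {T : Set (EuclideanSpace ℝ (Fin 2))}, Bornology.IsBounded T →
      ∫ z in T, (‖z - c‖ ^ 2 - s ^ 2) = (∫ z in T, ‖z - c‖ ^ 2) - volume.real T * s ^ 2 := by
    intro T hT
    rw [integral_sub (hT.integrableOn_norm_sub_sq c) (integrableOn_const hT.measure_lt_top.ne),
      setIntegral_const, smul_eq_mul]
  have hin : ∫ z in B \ S, (‖z - c‖ ^ 2 - s ^ 2) ≤ 0 := by
    refine setIntegral_nonpos (hBm.diff hS) fun z hz => ?_
    have : ‖z - c‖ ≤ s := by simpa [hB, dist_eq_norm] using hz.1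
    nlinarith [norm_nonneg (z - c)]
  have hout : 0 ≤ ∫ z in S \ B, (‖z - c‖ ^ 2 - s ^ 2) := by
    refine setIntegral_nonneg (hS.diff hBm) fun z hz => ?_
    have : s < ‖z - c‖ := by simpa [hB, dist_eq_norm] using hz.2
    nlinarith [norm_nonneg (z - c)]
  have e1 := integral_inter_add_sdiff hBm (hf hb)
  have e2 := integral_inter_add_sdiff hS (hf hBb)
  rw [Set.inter_comm] at e2
  rw [hval hb] at e1
  rw [hval hBb, integral_closedBall_norm_sub_sq c hs, volume_real_closedBall_fin_two c hs] at e2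
  have e3 : volume.real S ^ 2 / (2 * π) = π * s ^ 4 / 2 := by
    rw [← hs2]
    field_simp
  rw [e3]
  rw [← hs2] at e1
  linarith

/-- Let `Ω ⊆ ℝ²` be a bounded measurable set of positive area `|Ω|`, with centroid
`z_c = (1/|Ω|)·∫_Ω z dz`, polar moment of inertia `I_c(Ω) = ∫_Ω ‖z − z_c‖² dz`, and
Fraenkel modulus of asymmetry `α(Ω) = inf_{z ∈ ℝ²} |Ω \ D_z|/|Ω|`, where `D_z` is the
disk of center `z` and area `|Ω|` (i.e. radius `√(|Ω|/π)`).  Then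
`I_c(Ω) ≥ (|Ω|²/(2π)) · (1 + 2·α(Ω)²)`. -/
theorem polar_moment_asymmetry (Ω : Set (EuclideanSpace ℝ (Fin 2)))
    (hΩ : MeasurableSet Ω) (hbdd : Bornology.IsBounded Ω)
    (hpos : 0 < (volume Ω).toReal) :
    (volume Ω).toReal ^ 2 / (2 * π) *
        (1 + 2 * (⨅ z : EuclideanSpace ℝ (Fin 2),
          (volume (Ω \ Metric.closedBall z (Real.sqrt ((volume Ω).toReal / π)))).toReal /
            (volume Ω).toReal) ^ 2) ≤
      ∫ z in Ω, ‖z - ((volume Ω).toReal)⁻¹ • ∫ z' in Ω, z'‖ ^ 2 := by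
  set c : EuclideanSpace ℝ (Fin 2) := ((volume Ω).toReal)⁻¹ • ∫ z' in Ω, z'
  set A : ℝ := (volume Ω).toReal with hA
  set s : ℝ := √(A / π) with hs_def
  have hs : 0 ≤ s := Real.sqrt_nonneg _
  have hs2 : π * s ^ 2 = A := by
    rw [hs_def, Real.sq_sqrt (by positivity)]
    field_simp
  set D := Metric.closedBall c s
  have hDm : MeasurableSet D := Metric.isClosed_closedBall.measurableSet
  have hDb : Bornology.IsBounded D := Metric.isBounded_closedBall
  set a : ℝ := volume.real (Ω \ D) with ha
  have hinf0 : 0 ≤ ⨅ z : EuclideanSpace ℝ (Fin 2), (volume (Ω \ Metric.closedBall z s)).toReal / A :=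
    Real.iInf_nonneg fun z => by positivity
  have hinf : (⨅ z : EuclideanSpace ℝ (Fin 2), (volume (Ω \ Metric.closedBall z s)).toReal / A) ≤ a / A :=
    ciInf_le ⟨0, by rintro _ ⟨z, rfl⟩; positivity⟩ c
  have hvD : volume.real D = A := (volume_real_closedBall_fin_two c hs).trans hs2
  have hinter : volume.real (Ω ∩ D) = A - a := by
    have := measureReal_inter_add_sdiff (μ := volume) (s := Ω) hDm hbdd.measure_lt_top.ne
    rw [hA, ha, ← measureReal_def]
    linarith
  have hunion : volume.real (D ∪ Ω \ D) = A + a := by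
    rw [measureReal_union Set.disjoint_sdiff_right (hΩ.diff hDm) hDb.measure_lt_top.ne
      (hbdd.subset Set.sdiff_subset).measure_lt_top.ne, hvD]
  have hOD : Bornology.IsBounded (Ω \ D) := hbdd.subset Set.sdiff_subset
  have m1 := sq_volume_div_two_pi_le_integral_norm_sub_sq (hDm.union (hΩ.diff hDm))
    (hDb.union hOD) c
  have m2 := sq_volume_div_two_pi_le_integral_norm_sub_sq (hΩ.inter hDm)
    (hbdd.subset Set.inter_subset_left) c
  rw [hunion, setIntegral_union Set.disjoint_sdiff_right (hΩ.diff hDm)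
    (hDb.integrableOn_norm_sub_sq c) (hOD.integrableOn_norm_sub_sq c),
    integral_closedBall_norm_sub_sq c hs] at m1
  rw [hinter] at m2
  rw [← integral_inter_add_sdiff hDm (hbdd.integrableOn_norm_sub_sq c)]
  have e3 : π * s ^ 4 / 2 = A ^ 2 / (2 * π) := by
    rw [← hs2]
    field_simp
  calc _ ≤ A ^ 2 / (2 * π) * (1 + 2 * (a / A) ^ 2) := by gcongr
    _ = (A + a) ^ 2 / (2 * π) + (A - a) ^ 2 / (2 * π) - A ^ 2 / (2 * π) := by
      field_simp
      ring
    _ ≤ _ := by linarith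
end

section
/- Let a ≥ 1 and let E_a = {(x, y) ∈ ℝ² : x²/a² + a²·y² ≤ 1} be the ellipse of area π with semi-axes a and 1/a. Then the area of E_a \ B, where B is the closed unit disk centered at the origin, equals 2·arctan((a − 1/a)/2); consequently |E_a \ B|/|E_a| = (2/π)·arctan((a − 1/a)/2). -/
open Real MeasureTheory

/-- If, in polar coordinates, a measurable planar set is the sector `r ≤ 1`, `|θ| < α`,
then its area is `α`. -/
theorem volume_real_of_polarCoord_sector {S : Set (ℝ × ℝ)} (hS : MeasurableSet S) {α : ℝ}
    (hα : 0 ≤ α) (hαπ : α ≤ π)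
    (h : ∀ r θ : ℝ, 0 < r → θ ∈ Set.Ioo (-π) π →
      ((r * cos θ, r * sin θ) ∈ S ↔ r ≤ 1 ∧ θ ∈ Set.Ioo (-α) α)) :
    volume.real S = α := by
  have hT : MeasurableSet (Set.Ioc (0 : ℝ) 1 ×ˢ Set.Ioo (-α) α) :=
    measurableSet_Ioc.prod measurableSet_Ioo
  have hpolar := integral_comp_polarCoord_symm (S.indicator fun _ => (1 : ℝ))
  rw [integral_indicator_const _ hS, smul_eq_mul, mul_one] at hpolar
  have hsub : Set.Ioc (0 : ℝ) 1 ×ˢ Set.Ioo (-α) α ⊆ polarCoord.target := by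
    rintro ⟨r, θ⟩ ⟨hr, hθ⟩
    exact ⟨hr.1, by linarith [hθ.1], by linarith [hθ.2]⟩
  have hind : ∫ p in polarCoord.target,
      p.1 • S.indicator (fun _ => (1 : ℝ)) (polarCoord.symm p) =
      ∫ p in polarCoord.target,
        (Set.Ioc (0 : ℝ) 1 ×ˢ Set.Ioo (-α) α).indicator (fun p => p.1 * 1) p := by
    refine setIntegral_congr_fun polarCoord.open_target.measurableSet ?_
    rintro ⟨r, θ⟩ ⟨hr, hθ⟩
    have hr : 0 < r := hr
    have key := h r θ hr hθ
    by_cases hp : (r * cos θ, r * sin θ) ∈ S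
    · have h' := key.1 hp
      have hm : (r, θ) ∈ Set.Ioc (0 : ℝ) 1 ×ˢ Set.Ioo (-α) α := ⟨⟨hr, h'.1⟩, h'.2⟩
      simp only [polarCoord_symm_apply, Set.indicator_of_mem hp, Set.indicator_of_mem hm,
        smul_eq_mul]
    · have hm : (r, θ) ∉ Set.Ioc (0 : ℝ) 1 ×ˢ Set.Ioo (-α) α :=
        fun hm => hp (key.2 ⟨hm.1.2, hm.2⟩)
      simp only [polarCoord_symm_apply, Set.indicator_of_notMem hp, Set.indicator_of_notMem hm,
        smul_zero]
  rw [← hpolar, hind, setIntegral_indicator hT, Set.inter_eq_right.2 hsub,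
    Measure.volume_eq_prod, setIntegral_prod_mul (fun r : ℝ => r) (fun _ : ℝ => (1 : ℝ)),
    ← intervalIntegral.integral_of_le zero_le_one, integral_id, setIntegral_const,
    Real.volume_real_Ioo_of_le (by linarith)]
  simp only [smul_eq_mul]
  ring

theorem measurableSet_unitDisk : MeasurableSet {p : ℝ × ℝ | p.1 ^ 2 + p.2 ^ 2 ≤ 1} :=
  measurableSet_le (by fun_prop) (by fun_prop)

theorem volume_unitDisk_ne_top : volume {p : ℝ × ℝ | p.1 ^ 2 + p.2 ^ 2 ≤ 1} ≠ ⊤ := by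
  refine ((measure_mono ?_).trans_lt
    (isCompact_Icc (a := ((-1, -1) : ℝ × ℝ)) (b := (1, 1))).measure_lt_top).ne
  rintro ⟨x, y⟩ h
  have h : x ^ 2 + y ^ 2 ≤ 1 := h
  refine ⟨⟨?_, ?_⟩, ⟨?_, ?_⟩⟩ <;> dsimp only <;> nlinarith [sq_nonneg x, sq_nonneg y]

theorem volume_real_unitDisk : volume.real {p : ℝ × ℝ | p.1 ^ 2 + p.2 ^ 2 ≤ 1} = π := by
  refine volume_real_of_polarCoord_sector measurableSet_unitDisk pi_pos.le le_rfl ?_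
  intro r θ hr hθ
  have hsq : (r * cos θ) ^ 2 + (r * sin θ) ^ 2 = r ^ 2 := by
    linear_combination r ^ 2 * sin_sq_add_cos_sq θ
  rw [Set.mem_ofPred_eq, hsq, sq_le_one_iff₀ hr.le]
  exact ⟨fun h => ⟨h, hθ⟩, fun h => h.1⟩

/-- For `0 < r` and `θ` in `(-π, π)`, the point with polar coordinates `(r, θ)` lies in the right
half of the double cone `|y| < t|x|` exactly when `|θ| < arctan t`. -/
theorem polar_mem_cone_iff {t r θ : ℝ} (ht : 0 < t) (hr : 0 < r) (hθ : θ ∈ Set.Ioo (-π) π) :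
    (0 < r * cos θ ∧ (r * sin θ) ^ 2 < t ^ 2 * (r * cos θ) ^ 2) ↔
      θ ∈ Set.Ioo (-arctan t) (arctan t) := by
  have htan : ∀ φ : ℝ, 0 < cos φ →
      ((r * sin φ) ^ 2 < t ^ 2 * (r * cos φ) ^ 2 ↔ -t < tan φ ∧ tan φ < t) := by
    intro φ hc
    rw [← abs_lt, ← mul_pow, sq_lt_sq, abs_of_pos (by positivity : 0 < t * (r * cos φ)),
      tan_eq_sin_div_cos, abs_div, abs_of_pos hc, div_lt_iff₀ hc, abs_mul, abs_of_pos hr,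
      mul_left_comm, mul_lt_mul_iff_right₀ hr]
  have harctan := arctan_lt_pi_div_two t
  constructor
  · rintro ⟨hx, hy⟩
    have hc : 0 < cos θ := pos_of_mul_pos_right hx hr.le
    have h₁ : -(π / 2) < θ := by
      by_contra! h
      have := cos_nonpos_of_pi_div_two_le_of_le (x := -θ) (by linarith) (by linarith [hθ.1])
      rw [cos_neg] at this
      linarith
    have h₂ : θ < π / 2 := by
      by_contra! h
      have := cos_nonpos_of_pi_div_two_le_of_le h (by linarith [hθ.2])
      linarith
    obtain ⟨hl, hu⟩ := (htan θ hc).1 hy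
    rw [← arctan_tan h₁ h₂, ← arctan_neg]
    exact ⟨arctan_strictMono hl, arctan_strictMono hu⟩
  · rintro ⟨hl, hu⟩
    have h₁ : -(π / 2) < θ := by linarith
    have h₂ : θ < π / 2 := by linarith
    have hc : 0 < cos θ := cos_pos_of_mem_Ioo ⟨h₁, h₂⟩
    refine ⟨by positivity, (htan θ hc).2 ?_⟩
    rw [← arctan_tan h₁ h₂, ← arctan_neg] at hl
    rw [← arctan_tan h₁ h₂] at hu
    exact ⟨arctan_strictMono.lt_iff_lt.1 hl, arctan_strictMono.lt_iff_lt.1 hu⟩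

/-- The part of the unit disk inside the double cone `|y| < t|x|` has area `2 arctan t`. -/
theorem volume_real_unitDisk_inter_cone {t : ℝ} (ht : 0 < t) :
    volume.real ({p : ℝ × ℝ | p.1 ^ 2 + p.2 ^ 2 ≤ 1} ∩ {p | p.2 ^ 2 < t ^ 2 * p.1 ^ 2}) =
      2 * arctan t := by
  set S : Set (ℝ × ℝ) := {p : ℝ × ℝ | p.1 ^ 2 + p.2 ^ 2 ≤ 1} ∩
    ({p | 0 < p.1} ∩ {p | p.2 ^ 2 < t ^ 2 * p.1 ^ 2}) with hSdef
  have hS : MeasurableSet S := measurableSet_unitDisk.inter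
    ((measurableSet_lt (by fun_prop) (by fun_prop)).inter
      (measurableSet_lt (by fun_prop) (by fun_prop)))
  have hfin : volume S ≠ ⊤ := measure_ne_top_of_subset Set.inter_subset_left volume_unitDisk_ne_top
  have hvol : volume.real S = arctan t := by
    refine volume_real_of_polarCoord_sector hS (arctan_nonneg.2 ht.le)
      (by linarith [arctan_lt_pi_div_two t, pi_pos]) ?_
    intro r θ hr hθ
    have hsq : (r * cos θ) ^ 2 + (r * sin θ) ^ 2 = r ^ 2 := by
      linear_combination r ^ 2 * sin_sq_add_cos_sq θ
    rw [← polar_mem_cone_iff ht hr hθ, hSdef, Set.mem_inter_iff, Set.mem_inter_iff,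
      Set.mem_ofPred_eq, Set.mem_ofPred_eq, Set.mem_ofPred_eq, hsq, sq_le_one_iff₀ hr.le]
  have hneg : volume (-S) = volume S := Measure.measure_neg _ _
  have hunion : {p : ℝ × ℝ | p.1 ^ 2 + p.2 ^ 2 ≤ 1} ∩ {p | p.2 ^ 2 < t ^ 2 * p.1 ^ 2} =
      S ∪ -S := by
    ext ⟨x, y⟩
    simp only [hSdef, Set.mem_inter_iff, Set.mem_ofPred_eq, Set.mem_union, Set.mem_neg,
      Prod.fst_neg, Prod.snd_neg, even_two.neg_pow, Left.neg_pos_iff]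
    constructor
    · rintro ⟨h₁, h₂⟩
      rcases lt_trichotomy x 0 with hx | rfl | hx
      · exact Or.inr ⟨h₁, hx, h₂⟩
      · nlinarith [sq_nonneg y]
      · exact Or.inl ⟨h₁, hx, h₂⟩
    · rintro (⟨h₁, -, h₂⟩ | ⟨h₁, -, h₂⟩) <;> exact ⟨h₁, h₂⟩
  have hdisj : Disjoint S (-S) := by
    refine Set.disjoint_left.2 ?_
    rintro ⟨x, y⟩ h₁ h₂
    have hx : 0 < x := h₁.2.1
    have hx' : 0 < -x := h₂.2.1
    linarith
  rw [hunion, measureReal_union hdisj hS.neg hfin (hneg ▸ hfin), measureReal_def volume (-S),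
    hneg, ← measureReal_def, hvol]
  ring

/-- The map `(x, y) ↦ (x / a, a y)` preserves area. -/
theorem volume_preimage_squeeze {a : ℝ} (ha : a ≠ 0) (s : Set (ℝ × ℝ)) :
    volume ((fun p : ℝ × ℝ => (a⁻¹ * p.1, a * p.2)) ⁻¹' s) = volume s := by
  let f : ℝ × ℝ →ₗ[ℝ] ℝ × ℝ :=
    (a⁻¹ • LinearMap.id (R := ℝ) (M := ℝ)).prodMap (a • LinearMap.id (R := ℝ) (M := ℝ))
  have hdet : LinearMap.det f = 1 := by
    simp [f, LinearMap.det_prodMap, ha]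
  have h := Measure.addHaar_preimage_linearMap (volume : Measure (ℝ × ℝ)) (f := f)
    (by simp [hdet]) s
  rw [hdet, inv_one, abs_one, ENNReal.ofReal_one, one_mul] at h
  exact h

theorem arctan_sub_arctan_inv {a : ℝ} (ha : 0 < a) :
    arctan a - arctan a⁻¹ = arctan ((a - 1 / a) / 2) := by
  have h : a * -a⁻¹ = -1 := by field_simp
  rw [sub_eq_add_neg, ← arctan_neg, arctan_add (by rw [h]; norm_num), h]
  congr 1
  ring

/-- Let `a ≥ 1` and let `E_a = {(x, y) : x²/a² + a²·y² ≤ 1}` be the ellipse of area `π`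
with semi-axes `a` and `1/a`, and `B` the closed unit disk centered at the origin.
Then the area of `E_a \ B` equals `2·arctan((a − 1/a)/2)`; consequently
`|E_a \ B|/|E_a| = (2/π)·arctan((a − 1/a)/2)`. -/
theorem ellipse_asymmetry_area (a : ℝ) (ha : 1 ≤ a) :
    (volume ({p : ℝ × ℝ | p.1 ^ 2 / a ^ 2 + a ^ 2 * p.2 ^ 2 ≤ 1} \
        {p : ℝ × ℝ | p.1 ^ 2 + p.2 ^ 2 ≤ 1})).toReal =
      2 * Real.arctan ((a - 1 / a) / 2) ∧
    (volume ({p : ℝ × ℝ | p.1 ^ 2 / a ^ 2 + a ^ 2 * p.2 ^ 2 ≤ 1} \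
        {p : ℝ × ℝ | p.1 ^ 2 + p.2 ^ 2 ≤ 1})).toReal /
        (volume {p : ℝ × ℝ | p.1 ^ 2 / a ^ 2 + a ^ 2 * p.2 ^ 2 ≤ 1}).toReal =
      (2 / π) * Real.arctan ((a - 1 / a) / 2) := by
  have ha₀ : 0 < a := by linarith
  set B : Set (ℝ × ℝ) := {p : ℝ × ℝ | p.1 ^ 2 + p.2 ^ 2 ≤ 1} with hB
  set E : Set (ℝ × ℝ) := {p : ℝ × ℝ | p.1 ^ 2 / a ^ 2 + a ^ 2 * p.2 ^ 2 ≤ 1} with hE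
  let C : ℝ → Set (ℝ × ℝ) := fun t => {p | p.2 ^ 2 < t ^ 2 * p.1 ^ 2}
  have hform : ∀ x y : ℝ, x ^ 2 / a ^ 2 + a ^ 2 * y ^ 2 - (x ^ 2 + y ^ 2) =
      (a ^ 2 - 1) * (y ^ 2 - a⁻¹ ^ 2 * x ^ 2) := by
    intro x y
    field_simp
    ring
  have ha₁ : 0 ≤ a ^ 2 - 1 := by nlinarith
  have hEpre : E = (fun p : ℝ × ℝ => (a⁻¹ * p.1, a * p.2)) ⁻¹' B := by
    ext ⟨x, y⟩
    simp only [hE, hB, Set.mem_ofPred_eq, Set.mem_preimage, mul_pow, inv_pow, div_eq_inv_mul]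
  have hECpre : E ∩ C a⁻¹ = (fun p : ℝ × ℝ => (a⁻¹ * p.1, a * p.2)) ⁻¹' (B ∩ C a) := by
    rw [hEpre, Set.preimage_inter]
    congr 1
    ext ⟨x, y⟩
    simp only [C, Set.mem_ofPred_eq, Set.mem_preimage]
    rw [mul_pow a, mul_lt_mul_iff_right₀ (by positivity), mul_pow]
  have hdiff : E \ B = (E ∩ C a⁻¹) \ (B ∩ C a⁻¹) := by
    ext ⟨x, y⟩
    simp only [hE, hB, C, Set.mem_sdiff, Set.mem_inter_iff, Set.mem_ofPred_eq]
    constructor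
    · rintro ⟨h₁, h₂⟩
      refine ⟨⟨h₁, ?_⟩, fun h => h₂ h.1⟩
      by_contra! h
      nlinarith [hform x y, mul_nonneg ha₁ (sub_nonneg.2 h)]
    · rintro ⟨⟨h₁, h₃⟩, h₂⟩
      exact ⟨h₁, fun h => h₂ ⟨h, h₃⟩⟩
  have hsub : B ∩ C a⁻¹ ⊆ E ∩ C a⁻¹ := by
    rintro ⟨x, y⟩ ⟨h₁, h₂⟩
    refine ⟨?_, h₂⟩
    simp only [hE, hB, C, Set.mem_ofPred_eq] at h₁ h₂ ⊢
    nlinarith [hform x y, mul_nonneg ha₁ (sub_nonneg.2 h₂.le)]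
  have hmeas : MeasurableSet (B ∩ C a⁻¹) :=
    measurableSet_unitDisk.inter (measurableSet_lt (by fun_prop) (by fun_prop))
  have hBfin : volume (B ∩ C a) ≠ ⊤ :=
    measure_ne_top_of_subset Set.inter_subset_left volume_unitDisk_ne_top
  have hECvol : volume (E ∩ C a⁻¹) = volume (B ∩ C a) := by
    rw [hECpre, volume_preimage_squeeze ha₀.ne']
  have harea : (volume (E \ B)).toReal = 2 * arctan ((a - 1 / a) / 2) := by
    rw [← measureReal_def, hdiff, measureReal_sdiff hsub hmeas (hECvol ▸ hBfin),
      measureReal_def volume (E ∩ C a⁻¹), hECvol, ← measureReal_def,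
      volume_real_unitDisk_inter_cone ha₀, volume_real_unitDisk_inter_cone (inv_pos.2 ha₀),
      ← arctan_sub_arctan_inv ha₀]
    ring
  have hEvol : (volume E).toReal = π := by
    rw [hEpre, volume_preimage_squeeze ha₀.ne', ← measureReal_def, volume_real_unitDisk]
  refine ⟨harea, ?_⟩
  rw [harea, hEvol]
  ring
end
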